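/- In the double near algebra Q on ℝ⁶ × ℝ², for α, β, ρ, h₄, h₅, h₆ ∈ ℝ the element h = (α+β−ρ, 2ρ−β, −ρ, h₄, h₅, h₆; 0, 0) is a flow generator if and only if α ≥ 0, ρ ∈ [0,1], and β ≥ −2√(α(1−ρ)). -/

import Mathlib

section

variable {W : Type*} [AddCommGroup W] [Module ℝ W]

/-- `y` is a two-sided inverse of `x` for the multiplication `m` with identity `e`. -/
def InvPair (m : W → W → W) (e : W) (x y : W) : Prop := m x y = e ∧ m y x = e

/-- `h_r = r(1−r)•h + (1−r)•e_⋊ + r•e_⋉`. -/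
def hcurveOps (el er : W) (h : W) (r : ℝ) : W :=
  (r * (1 - r)) • h + (1 - r) • er + r • el

/-- `h` is a flow generator for the multiplications `lm` (⋉), `rm` (⋊) with identities
`el = e_⋉`, `er = e_⋊`: `h_u` is ⋉-invertible for `u > 0`, the elements
`w r u = h_u^{−⋉} ⋉ h_r` are ⋊-invertible (and ⋉-invertible) for `0 < r < u`, and for
all `0 < r < s < u` the element `w r s^{−⋊} ⋊ w s u^{−⋉}` is ⋉-invertible with
`w r u^{−⋊} ⋊ w s u = (w r s^{−⋊} ⋊ w s u^{−⋉})^{−⋉}`. -/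
def IsFlowGeneratorOps (lm rm : W → W → W) (el er : W) (h : W) : Prop :=
  (∀ u : ℝ, 0 < u → ∃ y, InvPair lm el (hcurveOps el er h u) y) ∧
  (∀ r u : ℝ, 0 < r → r < u → ∀ hui, InvPair lm el (hcurveOps el er h u) hui →
    ∃ y, InvPair rm er (lm hui (hcurveOps el er h r)) y) ∧
  (∀ s u : ℝ, 0 < s → s < u → ∀ hui, InvPair lm el (hcurveOps el er h u) hui →
    ∃ y, InvPair lm el (lm hui (hcurveOps el er h s)) y) ∧
  (∀ r s u : ℝ, 0 < r → r < s → s < u →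
    ∀ hsi hui wrui wrsi wsui,
      InvPair lm el (hcurveOps el er h s) hsi →
      InvPair lm el (hcurveOps el er h u) hui →
      InvPair rm er (lm hui (hcurveOps el er h r)) wrui →
      InvPair rm er (lm hsi (hcurveOps el er h r)) wrsi →
      InvPair lm el (lm hui (hcurveOps el er h s)) wsui →
      ∃ z, InvPair lm el (rm wrsi wsui) z ∧
        rm wrui (lm hui (hcurveOps el er h s)) = z)

end

/-- The carrier `ℝ⁶ × ℝ²` of the double near algebra `Q`. -/
abbrev QDNA : Type := (Fin 6 → ℝ) × (Fin 2 → ℝ)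

/-- The multiplication ⋊ of `Q`. -/
def qrm (a b : QDNA) : QDNA :=
  (![a.1 0 * b.1 0,
     a.1 1 * b.1 0 + a.2 0 * b.1 1,
     a.1 2 * b.1 0 + a.2 1 * b.1 1 + b.1 2,
     a.1 3 * b.1 0 + a.2 0 * b.1 3,
     a.1 4 * b.1 0 + a.2 1 * b.1 3 + b.1 4,
     a.1 5 * b.1 0 + b.1 5],
   ![a.2 0 * b.2 0, a.2 1 * b.2 0 + b.2 1])

/-- The multiplication ⋉ of `Q`. -/
def qlm (a b : QDNA) : QDNA :=
  (![b.1 0 + a.2 0 * b.1 1 + a.1 0 * b.1 2,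
     a.2 1 * b.1 1 + a.1 1 * b.1 2,
     a.1 2 * b.1 2,
     a.1 3 * b.1 2 + b.1 3 + a.2 0 * b.1 4,
     a.1 4 * b.1 2 + a.2 1 * b.1 4,
     a.1 5 * b.1 2 + b.1 5],
   ![b.2 0 + a.2 0 * b.2 1, a.2 1 * b.2 1])

/-- The identity `e_⋉ = (0,0,1,0,0,0;0,1)` of `Q`. -/
def qel : QDNA := (![0, 0, 1, 0, 0, 0], ![0, 1])

/-- The identity `e_⋊ = (1,0,0,0,0,0;1,0)` of `Q`. -/
def qer : QDNA := (![1, 0, 0, 0, 0, 0], ![1, 0])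

theorem q_ext {a b : QDNA} (h0 : a.1 0 = b.1 0) (h1 : a.1 1 = b.1 1) (h2 : a.1 2 = b.1 2)
    (h3 : a.1 3 = b.1 3) (h4 : a.1 4 = b.1 4) (h5 : a.1 5 = b.1 5)
    (k0 : a.2 0 = b.2 0) (k1 : a.2 1 = b.2 1) : a = b := by
  refine Prod.ext ?_ ?_
  · funext i; fin_cases i <;> assumption
  · funext i; fin_cases i <;> assumption

/-- explicit left inverse -/
noncomputable def qli (a : QDNA) : QDNA :=
  (![(a.2 0 * a.1 1 / a.2 1 - a.1 0) / a.1 2, - a.1 1 / (a.1 2 * a.2 1), 1 / a.1 2,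
     (a.2 0 * a.1 4 / a.2 1 - a.1 3) / a.1 2, - a.1 4 / (a.1 2 * a.2 1), - a.1 5 / a.1 2],
   ![- a.2 0 / a.2 1, 1 / a.2 1])

/-- explicit right inverse -/
noncomputable def qri (a : QDNA) : QDNA :=
  (![1 / a.1 0, - a.1 1 / (a.1 0 * a.2 0), (a.2 1 * a.1 1 / a.2 0 - a.1 2) / a.1 0,
     - a.1 3 / (a.1 0 * a.2 0), (a.2 1 * a.1 3 / a.2 0 - a.1 4) / a.1 0, - a.1 5 / a.1 0],
   ![1 / a.2 0, - a.2 1 / a.2 0])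

theorem qli_spec (a : QDNA) (h : a.1 2 ≠ 0) (k : a.2 1 ≠ 0) : InvPair qlm qel a (qli a) := by
  constructor <;> apply q_ext <;> simp [qlm, qli, qel] <;> field_simp <;> ring

theorem qri_spec (a : QDNA) (h : a.1 0 ≠ 0) (k : a.2 0 ≠ 0) : InvPair qrm qer a (qri a) := by
  constructor <;> apply q_ext <;> simp [qrm, qri, qer] <;> field_simp <;> ring

theorem ql_ne {a y : QDNA} (H : qlm a y = qel) : a.1 2 ≠ 0 ∧ a.2 1 ≠ 0 := by
  have h2 := congrArg (fun z : QDNA => z.1 2) H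
  have k1 := congrArg (fun z : QDNA => z.2 1) H
  simp [qlm, qel] at h2 k1
  constructor
  · intro h; simp [h] at h2
  · intro h; simp [h] at k1

theorem qr_ne {a y : QDNA} (H : qrm a y = qer) : a.1 0 ≠ 0 ∧ a.2 0 ≠ 0 := by
  have h2 := congrArg (fun z : QDNA => z.1 0) H
  have k1 := congrArg (fun z : QDNA => z.2 0) H
  simp [qrm, qer] at h2 k1
  constructor
  · intro h; simp [h] at h2
  · intro h; simp [h] at k1

theorem qlm_assoc (a b c : QDNA) : qlm (qlm a b) c = qlm a (qlm b c) := by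
  apply q_ext <;> simp [qlm] <;> ring

theorem qrm_assoc (a b c : QDNA) : qrm (qrm a b) c = qrm a (qrm b c) := by
  apply q_ext <;> simp [qrm] <;> ring

theorem ql_uniq {a y : QDNA} (H : qlm a y = qel) : y = qli a := by
  obtain ⟨h, k⟩ := ql_ne H
  have e1 : qlm qel y = y := by apply q_ext <;> simp [qlm, qel]
  have e2 : qlm (qli a) qel = qli a := by apply q_ext <;> simp [qlm, qel]
  rw [← e1, ← (qli_spec a h k).2, qlm_assoc, H, e2]

theorem qr_uniq {a y : QDNA} (H : qrm a y = qer) : y = qri a := by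
  obtain ⟨h, k⟩ := qr_ne H
  have e1 : qrm qer y = y := by apply q_ext <;> simp [qrm, qer]
  have e2 : qrm (qri a) qer = qri a := by apply q_ext <;> simp [qrm, qer]
  rw [← e1, ← (qri_spec a h k).2, qrm_assoc, H, e2]

theorem ql_pair {a y : QDNA} (H : qlm a y = qel) : InvPair qlm qel a y := by
  obtain ⟨h, k⟩ := ql_ne H
  rw [ql_uniq H]; exact qli_spec a h k

def GG (α β ρ r u : ℝ) : ℝ := 1 - ρ + u * ρ + r * (u * α + β - ρ)

/-- explicit form of `w_{ru}` -/
noncomputable def WW (α β ρ h4 h5 h6 r u : ℝ) : QDNA :=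
  (![(u - r) * GG α β ρ r u / (u * (1 - ρ + u * ρ)),
     r * (2 * ρ - β) * (u - r) / (u * (1 - ρ + u * ρ)),
     r * (1 - ρ + r * ρ) / (u * (1 - ρ + u * ρ)),
     r * (u - r) * (u * h4 - (1 - u) * h5) / (u * (1 - ρ + u * ρ)),
     r * (u - r) * h5 / (u * (1 - ρ + u * ρ)),
     r * (u - r) * h6 / (1 - ρ + u * ρ)],
   ![(u - r) / u, r / u])

def HH (α β ρ h4 h5 h6 : ℝ) : QDNA :=
  (![α + β - ρ, 2 * ρ - β, -ρ, h4, h5, h6], ![0, 0])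

theorem hc3 (α β ρ h4 h5 h6 u : ℝ) :
    (hcurveOps qel qer (HH α β ρ h4 h5 h6) u).1 2 = u * (1 - ρ + u * ρ) ∧
    (hcurveOps qel qer (HH α β ρ h4 h5 h6) u).2 1 = u := by
  constructor <;> simp [hcurveOps, qel, qer, HH]
  ring

theorem W_eq (α β ρ h4 h5 h6 r u : ℝ) (hu : u ≠ 0) (hq : 1 - ρ + u * ρ ≠ 0) :
    qlm (qli (hcurveOps qel qer (HH α β ρ h4 h5 h6) u))
      (hcurveOps qel qer (HH α β ρ h4 h5 h6) r) = WW α β ρ h4 h5 h6 r u := by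
  obtain ⟨e, -⟩ := hc3 α β ρ h4 h5 h6 u
  obtain ⟨Q, hQ⟩ : ∃ x, x = 1 - ρ + u * ρ := ⟨_, rfl⟩
  simp only [qli, e, WW, ← hQ] at hq ⊢
  apply q_ext <;> simp [qlm, hcurveOps, qel, qer, HH, GG] <;> field_simp <;>
    (try simp only [hQ]) <;> ring

theorem W_flow (α β ρ h4 h5 h6 r s u : ℝ) (hr : 0 < r) (hrs : r < s) (hsu : s < u)
    (qs : 1 - ρ + s * ρ ≠ 0) (qu : 1 - ρ + u * ρ ≠ 0)
    (grs : GG α β ρ r s ≠ 0) (gru : GG α β ρ r u ≠ 0) :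
    qlm (qrm (qri (WW α β ρ h4 h5 h6 r s)) (qli (WW α β ρ h4 h5 h6 s u)))
      (qrm (qri (WW α β ρ h4 h5 h6 r u)) (WW α β ρ h4 h5 h6 s u)) = qel := by
  have a1 : s ≠ 0 := by linarith
  have a2 : u ≠ 0 := by linarith
  have a3 : s - r ≠ 0 := by linarith
  have a4 : u - r ≠ 0 := by linarith
  have a5 : u - s ≠ 0 := by linarith
  obtain ⟨Qs, hQs⟩ : ∃ x, x = 1 - ρ + s * ρ := ⟨_, rfl⟩
  obtain ⟨Qu, hQu⟩ : ∃ x, x = 1 - ρ + u * ρ := ⟨_, rfl⟩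
  obtain ⟨Grs, hGrs⟩ : ∃ x, x = GG α β ρ r s := ⟨_, rfl⟩
  obtain ⟨Gru, hGru⟩ : ∃ x, x = GG α β ρ r u := ⟨_, rfl⟩
  obtain ⟨Gsu, hGsu⟩ : ∃ x, x = GG α β ρ s u := ⟨_, rfl⟩
  simp only [WW, ← hQs, ← hQu, ← hGrs, ← hGru, ← hGsu] at qs qu grs gru ⊢
  apply q_ext <;> simp [qlm, qrm, qri, qli, qel] <;> field_simp <;>
    (try simp only [hGrs, hGru, hGsu, hQs, hQu, GG]) <;> ring

theorem G_pos (α β ρ r u : ℝ) (hα : 0 ≤ α) (h0 : 0 ≤ ρ) (h1 : ρ ≤ 1)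
    (hβ : -2 * Real.sqrt (α * (1 - ρ)) ≤ β) (hr : 0 < r) (hu : r < u) :
    0 < GG α β ρ r u := by
  have e : GG α β ρ r u = α * r ^ 2 + β * r + (1 - ρ) + (u - r) * (ρ + α * r) := by
    unfold GG; ring
  rw [Real.sqrt_mul hα] at hβ
  have s1 := Real.sq_sqrt hα
  have s2 := Real.sq_sqrt (sub_nonneg.2 h1)
  have p : 0 ≤ α * r ^ 2 + β * r + (1 - ρ) := by
    nlinarith [sq_nonneg (√α * r - √(1 - ρ)), mul_le_mul_of_nonneg_right hβ hr.le]
  rw [e]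
  by_cases hz : 0 < ρ + α * r
  · have := mul_pos (sub_pos.2 hu) hz
    linarith
  · have har : 0 ≤ α * r := mul_nonneg hα hr.le
    have hρ : ρ = 0 := by linarith
    have ha : α * r = 0 := by linarith
    have ha : α = 0 := by
      rcases mul_eq_zero.1 ha with h | h
      · exact h
      · linarith
    subst hρ ha
    simp at hβ
    have := mul_nonneg hβ hr.le
    simp; linarith

theorem nec (α β ρ : ℝ) (h0 : 0 ≤ ρ) (h1 : ρ ≤ 1)
    (H : ∀ r u, 0 < r → r < u → GG α β ρ r u ≠ 0) :
    0 ≤ α ∧ -2 * Real.sqrt (α * (1 - ρ)) ≤ β := by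
  have pos : ∀ r u, 0 < r → r < u → 0 < GG α β ρ r u := by
    intro r u hr hu
    by_contra hn
    have hn : GG α β ρ r u < 0 := lt_of_le_of_ne (not_lt.1 hn) (H r u hr hu)
    have hq : 0 < 1 - ρ + u * ρ := by
      rcases h0.eq_or_lt with h | h
      · subst h; simp
      · have := mul_pos (hr.trans hu) h; linarith
    set q := 1 - ρ + u * ρ with hqd
    set g := GG α β ρ r u with hg
    have hg' : g = q + r * (u * α + β - ρ) := by rw [hg, hqd]; rfl
    have hd : 0 < q - g := by linarith
    have l : r * q / (q - g) < r := by
      rw [div_lt_iff₀ hd]; nlinarith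
    refine H (r * q / (q - g)) u (by positivity) (l.trans hu) ?_
    have : GG α β ρ (r * q / (q - g)) u = q + (r * q / (q - g)) * (u * α + β - ρ) := rfl
    rw [this]
    field_simp
    rw [hg']; ring
  have P : ∀ r, 0 < r → 0 ≤ α * r ^ 2 + β * r + (1 - ρ) := by
    intro r hr
    by_contra hn
    push Not at hn
    set p := α * r ^ 2 + β * r + (1 - ρ) with hp
    set L := |ρ + α * r| + 1 with hL
    have hLp : 0 < L := by positivity
    have := pos r (r + (-p) / L) hr (by have : 0 < -p / L := div_pos (by linarith) hLp
                                        linarith)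
    have e : GG α β ρ r (r + (-p) / L) = p + (-p) / L * (ρ + α * r) := by
      rw [hp]; unfold GG; ring
    rw [e] at this
    have h3 : (-p) / L * (ρ + α * r) ≤ (-p) / L * L :=
      mul_le_mul_of_nonneg_left (by have := le_abs_self (ρ + α * r); linarith)
        (div_nonneg (by linarith) hLp.le)
    rw [div_mul_cancel₀ _ hLp.ne'] at h3
    linarith
  have hα : 0 ≤ α := by
    by_contra hn
    push Not at hn
    have e : ∀ r u, GG α β ρ r u =
        α * r ^ 2 + β * r + (1 - ρ) + (u - r) * (ρ + α * r) := by
      intro r u; unfold GG; ring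
    obtain ⟨r, hr, hrr⟩ : ∃ r, 0 < r ∧ ρ + α * r = -1 :=
      ⟨(ρ + 1) / (-α), div_pos (by linarith) (by linarith), by
        have := hn.ne
        field_simp; ring⟩
    have p := P r hr
    have := pos r (r + (α * r ^ 2 + β * r + (1 - ρ)) + 1) hr (by linarith)
    rw [e, hrr] at this
    linarith
  refine ⟨hα, ?_⟩
  by_contra hn
  push Not at hn
  have hs := Real.sqrt_nonneg (α * (1 - ρ))
  have hsq := Real.sq_sqrt (mul_nonneg hα (sub_nonneg.2 h1))
  have hb : β < 0 := by linarith
  rcases hα.eq_or_lt with h | h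
  · subst h
    have := P (2 / (-β)) (div_pos (by norm_num) (by linarith))
    have e : β * (2 / (-β)) = -2 := by
      have := hb.ne
      field_simp
    rw [e] at this
    linarith
  · have := P (-β / (2 * α)) (div_pos (by linarith) (by linarith))
    have e : α * (-β / (2 * α)) ^ 2 + β * (-β / (2 * α)) + (1 - ρ) =
        (4 * (α * (1 - ρ)) - β ^ 2) / (4 * α) := by
      field_simp; ring
    rw [e] at this
    have h4 : (4 * (α * (1 - ρ)) - β ^ 2) / (4 * α) < 0 :=
      div_neg_of_neg_of_pos (by nlinarith) (by linarith)
    linarith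

/-- In `Q`, the element `h = (α+β−ρ, 2ρ−β, −ρ, h₄, h₅, h₆; 0, 0)` is a flow generator
iff `α ≥ 0`, `ρ ∈ [0,1]` and `β ≥ −2√(α(1−ρ))`. -/
theorem stmt14 (α β ρ h4 h5 h6 : ℝ) :
    IsFlowGeneratorOps qlm qrm qel qer
      ((![α + β - ρ, 2 * ρ - β, -ρ, h4, h5, h6], ![0, 0]) : QDNA) ↔
    (0 ≤ α ∧ ρ ∈ Set.Icc (0 : ℝ) 1 ∧ -2 * Real.sqrt (α * (1 - ρ)) ≤ β) := by
  change IsFlowGeneratorOps qlm qrm qel qer (HH α β ρ h4 h5 h6) ↔ _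
  have qpos : 0 ≤ ρ → ρ ≤ 1 → ∀ u, 0 < u → 0 < 1 - ρ + u * ρ := by
    intro h0 h1 u hu
    rcases h0.eq_or_lt with h | h
    · subst h; simp
    · have := mul_pos hu h; linarith
  have inv : 0 ≤ ρ → ρ ≤ 1 → ∀ u, 0 < u →
      InvPair qlm qel (hcurveOps qel qer (HH α β ρ h4 h5 h6) u)
        (qli (hcurveOps qel qer (HH α β ρ h4 h5 h6) u)) := by
    intro h0 h1 u hu
    obtain ⟨e1, e2⟩ := hc3 α β ρ h4 h5 h6 u
    apply qli_spec
    · rw [e1]; exact (mul_pos hu (qpos h0 h1 u hu)).ne'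
    · rw [e2]; exact hu.ne'
  constructor
  · rintro ⟨c1, c2, -, -⟩
    have ne : ∀ u, 0 < u → 1 - ρ + u * ρ ≠ 0 := by
      intro u hu
      obtain ⟨y, hy, -⟩ := c1 u hu
      have := (ql_ne hy).1
      rw [(hc3 α β ρ h4 h5 h6 u).1] at this
      exact right_ne_zero_of_mul this
    have h0 : 0 ≤ ρ := by
      by_contra hn
      push Not at hn
      refine ne ((ρ - 1) / ρ) (div_pos_of_neg_of_neg (by linarith) hn) ?_
      rw [div_mul_cancel₀ _ hn.ne]; ring
    have h1 : ρ ≤ 1 := by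
      by_contra hn
      push Not at hn
      refine ne ((ρ - 1) / ρ) (div_pos (by linarith) (by linarith)) ?_
      rw [div_mul_cancel₀ _ (by linarith)]; ring
    have := nec α β ρ h0 h1 (by
      intro r u hr hu hG
      have hu0 := hr.trans hu
      obtain ⟨y, hy, -⟩ := c2 r u hr hu _ (inv h0 h1 u hu0)
      rw [W_eq α β ρ h4 h5 h6 r u hu0.ne' (ne u hu0)] at hy
      apply (qr_ne hy).1
      simp [WW, hG])
    exact ⟨this.1, ⟨h0, h1⟩, this.2⟩
  · rintro ⟨hα, ⟨h0, h1⟩, hβ⟩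
    have gp := fun r u => G_pos α β ρ r u hα h0 h1 hβ
    refine ⟨fun u hu => ⟨_, inv h0 h1 u hu⟩, ?_, ?_, ?_⟩
    · intro r u hr hu hui hh
      have hu0 := hr.trans hu
      have hq := qpos h0 h1 u hu0
      rw [ql_uniq hh.1, W_eq α β ρ h4 h5 h6 r u hu0.ne' hq.ne']
      have g := gp r u hr hu
      have d : 0 < u - r := sub_pos.2 hu
      refine ⟨_, qri_spec _ ?_ ?_⟩
      · change (u - r) * GG α β ρ r u / (u * (1 - ρ + u * ρ)) ≠ 0
        positivity
      · change (u - r) / u ≠ 0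
        positivity
    · intro r u hr hu hui hh
      have hu0 := hr.trans hu
      have hq := qpos h0 h1 u hu0
      have hq' := qpos h0 h1 r hr
      rw [ql_uniq hh.1, W_eq α β ρ h4 h5 h6 r u hu0.ne' hq.ne']
      refine ⟨_, qli_spec _ ?_ ?_⟩
      · change r * (1 - ρ + r * ρ) / (u * (1 - ρ + u * ρ)) ≠ 0
        positivity
      · change r / u ≠ 0
        positivity
    · intro r s u hr hrs hsu hsi hui wrui wrsi wsui k1 k2 k3 k4 k5
      have hs0 := hr.trans hrs
      have hu0 := hs0.trans hsu
      have hqs := (qpos h0 h1 s hs0).ne'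
      have hqu := (qpos h0 h1 u hu0).ne'
      have w1 := ql_uniq k1.1
      have w2 := ql_uniq k2.1
      subst w1 w2
      rw [W_eq α β ρ h4 h5 h6 _ _ hu0.ne' hqu] at k3 k5
      rw [W_eq α β ρ h4 h5 h6 _ _ hs0.ne' hqs] at k4
      rw [W_eq α β ρ h4 h5 h6 _ _ hu0.ne' hqu]
      have w3 := qr_uniq k3.1
      have w4 := qr_uniq k4.1
      have w5 := ql_uniq k5.1
      subst w3 w4 w5
      exact ⟨_, ql_pair (W_flow α β ρ h4 h5 h6 r s u hr hrs hsu hqs hqu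
        (gp r s hr hrs).ne' (gp r u hr (hrs.trans hsu)).ne'), rfl⟩
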